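/- For each n ≥ 1 let A_n = (σ_ij) be an n×n matrix with nonnegative entries satisfying σ_ij ≤ σ_max for a constant σ_max independent of n, and set V_n = (1/n) A_n⊙A_n. Suppose that either (i) there exists σ_min > 0 with σ_ij ≥ σ_min for all n, i, j, or (ii) V_n is symmetric for every n. Then the family (V_n) is admissible: for every s > 0 there exists a constant C(s) < ∞ such that for all n ≥ 1 and all t ∈ (0,1], the unique positive solution (r, r̃) of the Regularized Master Equations associated with V_n satisfies (1/n) Σ_{i=1}^n r_i ≤ C(s). -/

import Mathlib

open Matrix Finset

/-- The Regularized Master Equations associated with a nonnegative `n × n` matrix `V`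
and parameters `s, t`: the unknowns `r, r̃ ∈ ℝⁿ` have positive entries and satisfy
`r_i = ((Vᵀ r)_i + t) / (s² + ((V r̃)_i + t)((Vᵀ r)_i + t))` and
`r̃_i = ((V r̃)_i + t) / (s² + ((V r̃)_i + t)((Vᵀ r)_i + t))`. -/
def RegME {n : ℕ} (V : Matrix (Fin n) (Fin n) ℝ) (s t : ℝ)
    (r rt : Fin n → ℝ) : Prop :=
  (∀ i, 0 < r i) ∧ (∀ i, 0 < rt i) ∧
  (∀ i, r i = ((Vᵀ.mulVec r) i + t) /
      (s ^ 2 + ((V.mulVec rt) i + t) * ((Vᵀ.mulVec r) i + t))) ∧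
  (∀ i, rt i = ((V.mulVec rt) i + t) /
      (s ^ 2 + ((V.mulVec rt) i + t) * ((Vᵀ.mulVec r) i + t)))

namespace RegME

variable {n : ℕ} {V : Matrix (Fin n) (Fin n) ℝ} {s t : ℝ} {r rt : Fin n → ℝ}

/-- A nonnegative matrix maps nonnegative vectors to nonnegative vectors. -/
lemma mulVec_nonneg_apply {M : Matrix (Fin n) (Fin n) ℝ} {x : Fin n → ℝ}
    (hM : ∀ i j, 0 ≤ M i j) (hx : ∀ i, 0 ≤ x i) (i : Fin n) : 0 ≤ (M.mulVec x) i :=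
  dotProduct_nonneg_of_nonneg (hM i) hx

/-- The sums of the two halves of a solution agree. -/
lemma sum_eq_sum (ht : 0 < t) (h : RegME V s t r rt) : ∑ i, r i = ∑ i, rt i := by
  obtain ⟨-, -, h1, h2⟩ := h
  have key : ∀ i, r i * ((V.mulVec rt) i + t) = rt i * ((Vᵀ.mulVec r) i + t) := by
    intro i
    rw [h1 i, h2 i]
    ring
  have hsum := Finset.sum_congr rfl fun i (_ : i ∈ Finset.univ) => key i
  simp only [mul_add, Finset.sum_add_distrib, ← Finset.sum_mul] at hsum
  have hdot : ∑ i, r i * (V.mulVec rt) i = ∑ i, rt i * (Vᵀ.mulVec r) i := by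
    change r ⬝ᵥ V.mulVec rt = rt ⬝ᵥ Vᵀ.mulVec r
    rw [Matrix.mulVec_transpose, Matrix.dotProduct_mulVec, dotProduct_comm]
  rw [hdot] at hsum
  exact mul_right_cancel₀ ht.ne' (add_left_cancel hsum)

/-- For a symmetric profile the two halves of a solution coincide. -/
lemma eq_of_symm (hs : 0 < s) (ht : 0 < t) (hV : ∀ i j, 0 ≤ V i j) (hsymm : Vᵀ = V)
    (h : RegME V s t r rt) : r = rt := by
  obtain ⟨hr, hrt, h1, h2⟩ := h
  rw [hsymm] at h1 h2
  set D : Fin n → ℝ := fun i => s ^ 2 + ((V.mulVec rt) i + t) * ((V.mulVec r) i + t) with hD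
  have hDpos : ∀ i, 0 < D i := fun i => by
    have ha := mulVec_nonneg_apply hV (fun j => (hr j).le) i
    have hb := mulVec_nonneg_apply hV (fun j => (hrt j).le) i
    simp only [hD]
    positivity
  have e1 : ∀ i, r i * D i = (V.mulVec r) i + t := fun i =>
    (eq_div_iff (hDpos i).ne').1 (h1 i)
  have e2 : ∀ i, rt i * D i = (V.mulVec rt) i + t := fun i =>
    (eq_div_iff (hDpos i).ne').1 (h2 i)
  set d : Fin n → ℝ := fun i => |r i - rt i| with hd
  have hle : ∀ i, d i * D i ≤ (V.mulVec d) i := fun i => by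
    have : (r i - rt i) * D i = ∑ j, V i j * (r j - rt j) := by
      simp only [mul_sub, Finset.sum_sub_distrib, sub_mul]
      rw [e1, e2]
      simp only [Matrix.mulVec, dotProduct]
      ring
    calc d i * D i = |∑ j, V i j * (r j - rt j)| := by
          rw [← this, abs_mul, abs_of_pos (hDpos i)]
      _ ≤ ∑ j, |V i j * (r j - rt j)| := Finset.abs_sum_le_sum_abs _ _
      _ = (V.mulVec d) i := by
          simp only [Matrix.mulVec, dotProduct, abs_mul, abs_of_nonneg (hV i _), hd]
  have hdot : ∑ i, r i * (V.mulVec d) i = ∑ i, d i * (V.mulVec r) i := by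
    change r ⬝ᵥ V.mulVec d = d ⬝ᵥ V.mulVec r
    rw [Matrix.dotProduct_mulVec, dotProduct_comm, ← Matrix.mulVec_transpose, hsymm]
  have hsum : ∑ i, r i * (d i * D i) ≤ ∑ i, r i * (V.mulVec d) i :=
    Finset.sum_le_sum fun i _ => mul_le_mul_of_nonneg_left (hle i) (hr i).le
  have hexp : ∑ i, r i * (d i * D i) = ∑ i, d i * (V.mulVec r) i + (∑ i, d i) * t := by
    rw [Finset.sum_mul, ← Finset.sum_add_distrib]
    refine Finset.sum_congr rfl fun i _ => ?_
    rw [← mul_add, ← e1 i]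
    ring
  have hd0 : ∀ i ∈ Finset.univ, 0 ≤ d i := fun i _ => abs_nonneg _
  have hzero : ∑ i, d i = 0 := by
    refine le_antisymm ?_ (Finset.sum_nonneg hd0)
    rw [hexp, hdot] at hsum
    exact nonpos_of_mul_nonpos_left (by linarith) ht
  funext i
  exact sub_eq_zero.1 (abs_eq_zero.1 ((Finset.sum_eq_zero_iff_of_nonneg hd0).1 hzero i
    (Finset.mem_univ i)))

/-- For a symmetric profile every entry of a solution is at most `1 / (2 * s)`. -/
lemma le_of_symm (hs : 0 < s) (ht : 0 < t) (hV : ∀ i j, 0 ≤ V i j) (hsymm : Vᵀ = V)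
    (h : RegME V s t r rt) (i : Fin n) : r i ≤ 1 / (2 * s) := by
  have heq := eq_of_symm hs ht hV hsymm h
  obtain ⟨hr, -, h1, -⟩ := h
  have ha := mulVec_nonneg_apply hV (fun j => (hr j).le) i
  rw [h1 i, hsymm, ← heq, div_le_div_iff₀ (by positivity) (by positivity)]
  nlinarith [sq_nonneg (s - ((V.mulVec r) i + t))]

/-- If the entries of the profile are at least `σ ^ 2 / n`, the average of a solution is
at most `1 / σ`. -/
lemma average_le_of_le (hn : 1 ≤ n) (ht : 0 < t) {σ : ℝ} (hσ : 0 < σ)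
    (hV : ∀ i j, (n : ℝ)⁻¹ * σ ^ 2 ≤ V i j) (h : RegME V s t r rt) :
    (n : ℝ)⁻¹ * ∑ i, r i ≤ 1 / σ := by
  have hs := sum_eq_sum ht h
  obtain ⟨hr, hrt, h1, -⟩ := h
  have hn0 : (0 : ℝ) < n := by exact_mod_cast hn
  have hV0 : ∀ i j, 0 ≤ V i j := fun i j => le_trans (by positivity) (hV i j)
  set m : ℝ := (n : ℝ)⁻¹ * ∑ i, r i with hm
  have hm0 : 0 ≤ m := mul_nonneg (by positivity) (Finset.sum_nonneg fun i _ => (hr i).le)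
  have hpt : ∀ i, r i * (σ ^ 2 * m) ≤ 1 := fun i => by
    have hlow : σ ^ 2 * m ≤ (V.mulVec rt) i := by
      calc σ ^ 2 * m = ∑ j, (n : ℝ)⁻¹ * σ ^ 2 * rt j := by
            rw [hm, hs, ← Finset.mul_sum]; ring
        _ ≤ (V.mulVec rt) i :=
            Finset.sum_le_sum fun j _ => mul_le_mul_of_nonneg_right (hV i j) (hrt j).le
    have ha := mulVec_nonneg_apply hV0 (fun j => (hrt j).le) i
    have hb := mulVec_nonneg_apply (M := Vᵀ) (fun j k => hV0 k j) (fun j => (hr j).le) i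
    calc r i * (σ ^ 2 * m) ≤ r i * ((V.mulVec rt) i + t) :=
          mul_le_mul_of_nonneg_left (by linarith) (hr i).le
      _ ≤ 1 := by
          rw [h1 i, div_mul_eq_mul_div, div_le_one (by positivity)]
          nlinarith [sq_nonneg s]
  have hsum : m * (σ ^ 2 * m) ≤ 1 := by
    calc m * (σ ^ 2 * m) = (n : ℝ)⁻¹ * ∑ i, r i * (σ ^ 2 * m) := by
          rw [← Finset.sum_mul, ← mul_assoc (n : ℝ)⁻¹, ← hm]
      _ ≤ (n : ℝ)⁻¹ * ∑ _i : Fin n, (1 : ℝ) := by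
          gcongr with i
          exact hpt i
      _ = 1 := by simp [hn0.ne']
  rw [le_div_iff₀ hσ]
  exact abs_le_of_sq_le_sq' (by linarith [mul_pow m σ 2]) zero_le_one |>.2

end RegME

/-- Boundedness of the variances plus either a uniform lower bound on the entries or
symmetry of the variance profile implies admissibility: for every `s > 0` the
normalized sums `(1/n) ∑ᵢ rᵢ(s,t)` of the solutions of the Regularized Master
Equations are bounded uniformly in `n ≥ 1` and `t ∈ (0,1]`. -/
theorem admissibility_of_variance_profile
    (A : ∀ n : ℕ, Matrix (Fin n) (Fin n) ℝ)
    (V : ∀ n : ℕ, Matrix (Fin n) (Fin n) ℝ)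
    (hVdef : ∀ n, V n = (n : ℝ)⁻¹ • (Matrix.hadamard (A n) (A n)))
    (σmax : ℝ) (hσmax : 0 < σmax)
    (hA : ∀ n, ∀ i j : Fin n, 0 ≤ A n i j ∧ A n i j ≤ σmax)
    (hcase : (∃ σmin : ℝ, 0 < σmin ∧ ∀ n, ∀ i j : Fin n, σmin ≤ A n i j) ∨
      (∀ n, (V n)ᵀ = V n)) :
    ∀ s > 0, ∃ C : ℝ, ∀ n : ℕ, 1 ≤ n → ∀ t ∈ Set.Ioc (0:ℝ) 1,
      ∀ r rt : Fin n → ℝ, RegME (V n) s t r rt →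
        (n : ℝ)⁻¹ * ∑ i, r i ≤ C := by
  intro s hs
  rcases hcase with ⟨σ, hσ, hlow⟩ | hsymm
  · refine ⟨1 / σ, fun n hn t ht r rt h => h.average_le_of_le hn ht.1 hσ fun i j => ?_⟩
    rw [hVdef n, Matrix.smul_apply, Matrix.hadamard_apply, smul_eq_mul, sq]
    have h1 := hlow n i j
    have h2 := (hA n i j).1
    gcongr
  · refine ⟨1 / (2 * s), fun n hn t ht r rt h => ?_⟩
    have hV : ∀ i j, 0 ≤ V n i j := fun i j => by
      rw [hVdef n, Matrix.smul_apply, Matrix.hadamard_apply, smul_eq_mul]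
      exact mul_nonneg (by positivity) (mul_self_nonneg _)
    have hn0 : (n : ℝ) ≠ 0 := by exact_mod_cast Nat.one_le_iff_ne_zero.1 hn
    calc (n : ℝ)⁻¹ * ∑ i, r i ≤ (n : ℝ)⁻¹ * ∑ _i : Fin n, 1 / (2 * s) := by
          gcongr with i
          exact h.le_of_symm hs ht.1 hV (hsymm n) i
      _ = 1 / (2 * s) := by
          rw [Finset.sum_const, Finset.card_univ, Fintype.card_fin, nsmul_eq_mul,
            inv_mul_cancel_left₀ hn0]
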